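/- Let (X, μ) be a Borel probability space and ν another Borel probability measure on X (e.g., an empirical measure). Let Y = {1,…,k} with k ≥ 2, c : X → Y measurable, and η, η̂ : X → [0,1]^k measurable. Let α ∈ (0,1), δ ∈ (0, α), δ_η ≥ 0, and let E ⊆ X be Borel. Assume: (i) μ(E) ≥ α; (ii) |μ(E) − ν(E)| ≤ δ; (iii) ∫_X ‖η(x) − η̂(x)‖₁ dμ(x) ≤ δ_η; and (iv) |∫_E lu(x; c, η̂) dμ(x) − ∫_E lu(x; c, η̂) dν(x)| ≤ 2δ. Then |LU(E; μ, c, η) − LU(E; ν, c, η̂)| ≤ (4δ + δ_η)/(α − δ). -/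

import Mathlib

open MeasureTheory ProbabilityTheory Metric Set
open scoped ENNReal NNReal

noncomputable section

/-- The pointwise label uncertainty `lu(x; c, η) = 1 - [η(x)]_{c(x)} + max_{y ≠ c(x)} [η(x)]_y`. -/
noncomputable def lu {X : Type*} {k : ℕ} (c : X → Fin k) (η : X → Fin k → ℝ) (x : X) : ℝ :=
  1 - η x (c x) + ⨆ i : {i : Fin k // i ≠ c x}, η x i

/-- The label uncertainty `LU(E; μ, c, η) = (1/μ(E)) ∫_E lu(x; c, η) dμ(x)` of a set `E`. -/
noncomputable def LU {X : Type*} [MeasurableSpace X] {k : ℕ} (E : Set X) (μ : Measure X)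
    (c : X → Fin k) (η : X → Fin k → ℝ) : ℝ :=
  (μ E).toReal⁻¹ * ∫ x in E, lu c η x ∂μ

lemma lu_meas {X : Type*} [MeasurableSpace X] {k : ℕ} (c : X → Fin k) (hc : Measurable c)
    (η : X → Fin k → ℝ) (hη : Measurable η) : Measurable (lu c η) := by
  have key : Measurable (fun p : Fin k × (Fin k → ℝ) =>
      1 - p.2 p.1 + ⨆ i : {i : Fin k // i ≠ p.1}, p.2 i) := by
    apply measurable_from_prod_countable_right
    intro j
    refine Measurable.add (measurable_const.sub (measurable_pi_apply j)) ?_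
    exact Measurable.iSup (f := fun (i : {i : Fin k // i ≠ j}) (y : Fin k → ℝ) => y i)
      (fun i => measurable_pi_apply (i : Fin k))
  exact key.comp (hc.prodMk hη)

lemma lu_bounds {X : Type*} {k : ℕ} (c : X → Fin k) (η : X → Fin k → ℝ)
    (h : ∀ x i, η x i ∈ Set.Icc (0:ℝ) 1) (x : X) : 0 ≤ lu c η x ∧ lu c η x ≤ 2 := by
  have a : (⨆ i : {i : Fin k // i ≠ c x}, η x i) ≤ 1 :=
    Real.iSup_le (fun i => (h x i).2) zero_le_one
  have b : 0 ≤ (⨆ i : {i : Fin k // i ≠ c x}, η x i) :=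
    Real.iSup_nonneg (fun i => (h x i).1)
  have := (h x (c x)).1
  have := (h x (c x)).2
  unfold lu
  constructor <;> linarith

lemma lu_sub {X : Type*} {k : ℕ} (c : X → Fin k) (η θ : X → Fin k → ℝ)
    (h' : ∀ x i, θ x i ∈ Set.Icc (0:ℝ) 1) (x : X) :
    lu c η x - lu c θ x ≤ ∑ i, |η x i - θ x i| := by
  have e : ∑ i, |η x i - θ x i| = |η x (c x) - θ x (c x)|
      + ∑ i ∈ Finset.univ.erase (c x), |η x i - θ x i| :=
    (Finset.add_sum_erase _ _ (Finset.mem_univ _)).symm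
  have nn : 0 ≤ ∑ i ∈ Finset.univ.erase (c x), |η x i - θ x i| :=
    Finset.sum_nonneg (fun _ _ => abs_nonneg _)
  have b : 0 ≤ (⨆ i : {i : Fin k // i ≠ c x}, θ x i) :=
    Real.iSup_nonneg (fun i => (h' x i).1)
  have a : (⨆ i : {i : Fin k // i ≠ c x}, η x i) ≤ (⨆ i : {i : Fin k // i ≠ c x}, θ x i)
      + ∑ i ∈ Finset.univ.erase (c x), |η x i - θ x i| := by
    refine Real.iSup_le (fun i => ?_) (by linarith)
    have h1 : θ x i ≤ ⨆ i : {i : Fin k // i ≠ c x}, θ x i :=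
      le_ciSup (f := fun i : {i : Fin k // i ≠ c x} => θ x i) (Set.finite_range _).bddAbove i
    have h2 : |η x i - θ x i| ≤ ∑ i ∈ Finset.univ.erase (c x), |η x i - θ x i| :=
      Finset.single_le_sum (f := fun i => |η x i - θ x i|) (fun _ _ => abs_nonneg _)
        (Finset.mem_erase.2 ⟨i.2, Finset.mem_univ _⟩)
    linarith [le_abs_self (η x i - θ x i)]
  have := neg_abs_le (η x (c x) - θ x (c x))
  unfold lu
  linarith

lemma lu_int {X : Type*} [MeasurableSpace X] (μ : Measure X) [IsFiniteMeasure μ]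
    {k : ℕ} (c : X → Fin k) (hc : Measurable c)
    (η : X → Fin k → ℝ) (hη : Measurable η) (h : ∀ x i, η x i ∈ Set.Icc (0:ℝ) 1) :
    Integrable (lu c η) μ := by
  refine Integrable.of_bound (lu_meas c hc η hη).aestronglyMeasurable 2 (ae_of_all _ fun x => ?_)
  have := lu_bounds c η h x
  rw [Real.norm_eq_abs, abs_le]
  constructor <;> linarith

/-- Deterministic single-set label uncertainty estimation bound: if `μ(E) ≥ α`,
`|μ(E) − ν(E)| ≤ δ`, `∫‖η − η̂‖₁ dμ ≤ δ_η`, and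
`|∫_E lu(·; c, η̂) dμ − ∫_E lu(·; c, η̂) dν| ≤ 2δ`, then
`|LU(E; μ, c, η) − LU(E; ν, c, η̂)| ≤ (4δ + δ_η)/(α − δ)`. -/
theorem stmt_5 {X : Type*} [MeasurableSpace X] (μ ν : Measure X)
    [IsProbabilityMeasure μ] [IsProbabilityMeasure ν]
    (k : ℕ) (hk : 2 ≤ k) (c : X → Fin k) (hc : Measurable c)
    (η ηhat : X → Fin k → ℝ) (hη : Measurable η) (hηhat : Measurable ηhat)
    (hη01 : ∀ x i, η x i ∈ Set.Icc (0:ℝ) 1) (hηhat01 : ∀ x i, ηhat x i ∈ Set.Icc (0:ℝ) 1)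
    (α δ δη : ℝ) (hα : α ∈ Set.Ioo (0:ℝ) 1) (hδ : δ ∈ Set.Ioo 0 α) (hδη : 0 ≤ δη)
    (E : Set X) (hE : MeasurableSet E)
    (h1 : α ≤ (μ E).toReal)
    (h2 : |(μ E).toReal - (ν E).toReal| ≤ δ)
    (h3 : ∫ x, (∑ i, |η x i - ηhat x i|) ∂μ ≤ δη)
    (h4 : |(∫ x in E, lu c ηhat x ∂μ) - ∫ x in E, lu c ηhat x ∂ν| ≤ 2*δ) :
    |LU E μ c η - LU E ν c ηhat| ≤ (4*δ + δη)/(α - δ) := by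
  obtain ⟨hδ0, hδα⟩ := hδ
  have hα0 := hα.1
  have iη := lu_int μ c hc η hη hη01
  have iθ := lu_int μ c hc ηhat hηhat hηhat01
  have iS : Integrable (fun x => ∑ i, |η x i - ηhat x i|) μ := by
    refine integrable_finsetSum _ (fun i _ => ?_)
    have m : Measurable (fun x => |η x i - ηhat x i|) := by
      have a1 : Measurable (fun x => η x i) := (measurable_pi_apply i).comp hη
      have a2 : Measurable (fun x => ηhat x i) := (measurable_pi_apply i).comp hηhat
      exact (a1.sub a2).abs
    refine Integrable.of_bound m.aestronglyMeasurable 1 (ae_of_all _ fun x => ?_)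
    have q1 := hη01 x i
    have q2 := hηhat01 x i
    rw [Real.norm_eq_abs, abs_abs, abs_le]
    constructor <;> linarith [q1.1, q1.2, q2.1, q2.2]
  have hAB : |(∫ x in E, lu c η x ∂μ) - ∫ x in E, lu c ηhat x ∂μ| ≤ δη := by
    rw [← integral_sub iη.integrableOn iθ.integrableOn]
    calc |∫ x in E, (lu c η x - lu c ηhat x) ∂μ|
        ≤ ∫ x in E, |lu c η x - lu c ηhat x| ∂μ := abs_integral_le_integral_abs
      _ ≤ ∫ x in E, (∑ i, |η x i - ηhat x i|) ∂μ := by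
          refine integral_mono (iη.sub iθ).abs.integrableOn iS.integrableOn (fun x => ?_)
          refine abs_sub_le_iff.2 ⟨lu_sub c η ηhat hηhat01 x, ?_⟩
          have := lu_sub c ηhat η hη01 x
          simpa only [abs_sub_comm] using this
      _ ≤ ∫ x, (∑ i, |η x i - ηhat x i|) ∂μ :=
          setIntegral_le_integral iS
            (ae_of_all _ fun x => Finset.sum_nonneg (fun _ _ => abs_nonneg _))
      _ ≤ δη := h3
  have hA0 : 0 ≤ ∫ x in E, lu c η x ∂μ := integral_nonneg (fun x => (lu_bounds c η hη01 x).1)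
  have hA2 : ∫ x in E, lu c η x ∂μ ≤ 2 * (μ E).toReal := by
    calc ∫ x in E, lu c η x ∂μ ≤ ∫ x in E, (2:ℝ) ∂μ :=
          integral_mono iη.integrableOn (integrable_const _) (fun x => (lu_bounds c η hη01 x).2)
      _ = 2 * (μ E).toReal := by
          simp [Measure.real, mul_comm]
  unfold LU
  generalize (∫ x in E, lu c η x ∂μ) = A at *
  generalize (∫ x in E, lu c ηhat x ∂μ) = B at *
  generalize (∫ x in E, lu c ηhat x ∂ν) = C at *
  generalize (μ E).toReal = m at *
  generalize (ν E).toReal = n at *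
  have hm : 0 < m := by linarith
  have hn' : α - δ ≤ n := by linarith [(abs_le.1 h2).2]
  have hn : 0 < n := by linarith
  have e : m⁻¹ * A - n⁻¹ * C = ((A - B) + (B - C) + (A / m) * (n - m)) / n := by
    field_simp
    ring
  have r0 : 0 ≤ A / m := by positivity
  have r2 : A / m ≤ 2 := by rw [div_le_iff₀ hm]; exact hA2
  have t : |(A / m) * (n - m)| ≤ 2 * δ := by
    rw [abs_mul, abs_of_nonneg r0, abs_sub_comm]
    exact mul_le_mul r2 h2 (abs_nonneg _) (by norm_num)
  rw [e, abs_div, abs_of_pos hn]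
  have s : |(A - B) + (B - C) + (A / m) * (n - m)| ≤ 4 * δ + δη := by
    have := abs_add_three (A - B) (B - C) ((A / m) * (n - m))
    linarith
  exact div_le_div₀ (by linarith) s (by linarith) hn'
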